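/- Let n ≥ 4 and k ≥ 2 be integers, and let 𝒯 be a finite nonempty set of labelled graphs on vertex set {1,…,n} with the property that for every labelled n-point set p in ℝ², at most one member of 𝒯 admits a label-preserving straight-line embedding on p. Write M = |𝒯|. If t_s(n,2) · (n!)^{k−1} < M^k, then there exist graphs T₁, …, T_k ∈ 𝒯 such that the collection {T₁,…,T_k} is not simultaneously embeddable, i.e., no point set P ⊆ ℝ² of size n admits straight-line embeddings of all of T₁,…,T_k. -/

import Mathlib

noncomputable section

/-- The Euclidean plane. -/
abbrev Plane := EuclideanSpace ℝ (Fin 2)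

/-- `π` is a straight-line embedding of the simple graph `G` in the plane:
it is injective, the closed segments of two distinct edges meet only in images of
common endpoints, and no vertex image lies in the open segment of a non-incident edge. -/
def IsSLEmbedding {V : Type*} (G : SimpleGraph V) (π : V → Plane) : Prop :=
  Function.Injective π ∧
  (∀ u v x y : V, G.Adj u v → G.Adj x y → s(u, v) ≠ s(x, y) →
    segment ℝ (π u) (π v) ∩ segment ℝ (π x) (π y) ⊆ π '' (({u, v} : Set V) ∩ ({x, y} : Set V))) ∧
  (∀ u v w : V, G.Adj u v → w ≠ u → w ≠ v → π w ∉ openSegment ℝ (π u) (π v))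

/-- `G` embeds straight-line on the point set `P`. -/
def EmbedsOn {V : Type*} (G : SimpleGraph V) (P : Set Plane) : Prop :=
  ∃ π : V → Plane, IsSLEmbedding G π ∧ Set.range π = P

/-- `G` embeds straight-line on some point set (equivalently, `G` is planar). -/
def PlanarEmbeddable {V : Type*} (G : SimpleGraph V) : Prop :=
  ∃ π : V → Plane, IsSLEmbedding G π

/-- A family of graphs on `n` vertices is simultaneously embeddable if there is a point
set of size `n` on which every member embeds straight-line. -/
def SimultaneouslyEmbeddable {n : ℕ} (𝒢 : Set (SimpleGraph (Fin n))) : Prop :=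
  ∃ P : Finset Plane, P.card = n ∧ ∀ G ∈ 𝒢, EmbedsOn G ↑P

/-- A conflict collection: a family of planar-embeddable graphs on `n` vertices that is
not simultaneously embeddable. -/
def ConflictCollection {n : ℕ} (𝒢 : Set (SimpleGraph (Fin n))) : Prop :=
  (∀ G ∈ 𝒢, PlanarEmbeddable G) ∧ ¬ SimultaneouslyEmbeddable 𝒢

/-- The orientation of an ordered triple of points in the plane: the sign of the
determinant of [[1,1,1],[a₁,b₁,c₁],[a₂,b₂,c₂]]. -/
def orient (a b c : Plane) : ℝ :=
  Real.sign (Matrix.det !![(1 : ℝ), 1, 1; a 0, b 0, c 0; a 1, b 1, c 1])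

/-- A labelled point tuple is in general position if every triple of points with
distinct indices has nonzero orientation. -/
def GenPos {n : ℕ} (p : Fin n → Plane) : Prop :=
  ∀ i j k : Fin n, i ≠ j → i ≠ k → j ≠ k → orient (p i) (p j) (p k) ≠ 0

/-- Two labelled point tuples are isomorphic (have the same labelled order type) if
all increasing index triples have the same orientation. -/
def OTIso {n : ℕ} (p q : Fin n → Plane) : Prop :=
  ∀ i j k : Fin n, i < j → j < k → orient (p i) (p j) (p k) = orient (q i) (q j) (q k)

/-- Labelled `n`-point sets in general position. -/
def GPTuple (n : ℕ) := {p : Fin n → Plane // Function.Injective p ∧ GenPos p}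

/-- `tS n` is the number `t_s(n,2)` of simple labelled order types: the number of
isomorphism classes of labelled `n`-point sets in general position. -/
def tS (n : ℕ) : ℕ := Nat.card (Quot fun p q : GPTuple n => OTIso p.1 q.1)

open Filter Topology

/-- Twice the signed area of the triangle `a b c`. -/
def signedArea (a b c : Plane) : ℝ :=
  (b 0 - a 0) * (c 1 - a 1) - (b 1 - a 1) * (c 0 - a 0)

theorem orient_eq_sign_signedArea (a b c : Plane) :
    orient a b c = Real.sign (signedArea a b c) := by
  unfold orient signedArea
  congr 1
  simp [Matrix.det_fin_three]
  ring

theorem orient_ne_zero_iff (a b c : Plane) : orient a b c ≠ 0 ↔ signedArea a b c ≠ 0 := by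
  rw [orient_eq_sign_signedArea, Ne, Real.sign_eq_zero_iff]

theorem orient_swap_left (a b c : Plane) : orient b a c = -orient a b c := by
  rw [orient_eq_sign_signedArea, orient_eq_sign_signedArea, ← Real.sign_neg]
  congr 1
  unfold signedArea
  ring

theorem orient_swap_right (a b c : Plane) : orient a c b = -orient a b c := by
  rw [orient_eq_sign_signedArea, orient_eq_sign_signedArea, ← Real.sign_neg]
  congr 1
  unfold signedArea
  ring

theorem Real.sign_mul_sign_neg_iff (x y : ℝ) : Real.sign x * Real.sign y < 0 ↔ x * y < 0 := by
  rcases lt_trichotomy x 0 with hx | rfl | hx <;> rcases lt_trichotomy y 0 with hy | rfl | hy <;>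
    simp [Real.sign_of_neg, Real.sign_of_pos, mul_neg_iff, not_lt_of_gt, *]

theorem mem_segment_plane_iff (a b z : Plane) : z ∈ segment ℝ a b ↔
    ∃ t : ℝ, 0 ≤ t ∧ t ≤ 1 ∧ ∀ i, z i = a i + t * (b i - a i) := by
  rw [segment_eq_image']
  constructor
  · rintro ⟨t, ⟨h0, h1⟩, rfl⟩
    exact ⟨t, h0, h1, fun i => by simp⟩
  · rintro ⟨t, h0, h1, h⟩
    refine ⟨t, ⟨h0, h1⟩, ?_⟩
    ext i
    simp [h]

/-- If `c`, `d` are off the line `a b` and the segments meet, then that line separates them. -/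
theorem signedArea_mul_neg_of_segments_meet {a b c d z : Plane}
    (hc : signedArea a b c ≠ 0) (hd : signedArea a b d ≠ 0)
    (hab : z ∈ segment ℝ a b) (hcd : z ∈ segment ℝ c d) :
    signedArea a b c * signedArea a b d < 0 := by
  obtain ⟨s, -, -, hs⟩ := (mem_segment_plane_iff _ _ _).1 hab
  obtain ⟨t, ht0, ht1, ht⟩ := (mem_segment_plane_iff _ _ _).1 hcd
  have key : (1 - t) * signedArea a b c + t * signedArea a b d = 0 := by
    have h0 := hs 0
    have h1 := hs 1
    rw [ht] at h0 h1
    unfold signedArea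
    linear_combination (b 0 - a 0) * h1 - (b 1 - a 1) * h0
  by_contra! h
  have hpos := lt_of_le_of_ne h (mul_ne_zero hc hd).symm
  rcases eq_or_lt_of_le ht0 with rfl | ht0
  · simp at key
    exact hc key
  · have h1 : (1 - t) * signedArea a b c ^ 2 + t * (signedArea a b c * signedArea a b d) = 0 := by
      linear_combination signedArea a b c * key
    have h2 := mul_pos ht0 hpos
    have h3 := mul_nonneg (sub_nonneg.2 ht1) (sq_nonneg (signedArea a b c))
    linarith

theorem segments_meet_of_signedArea_mul_neg {a b c d : Plane}
    (h₁ : signedArea a b c * signedArea a b d < 0)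
    (h₂ : signedArea c d a * signedArea c d b < 0) :
    (segment ℝ a b ∩ segment ℝ c d).Nonempty := by
  have param : ∀ x y : ℝ, x * y < 0 → x - y ≠ 0 ∧ 0 ≤ x / (x - y) ∧ x / (x - y) ≤ 1 := by
    intro x y h
    rcases mul_neg_iff.1 h with ⟨hx, hy⟩ | ⟨hx, hy⟩
    · exact ⟨by linarith, div_nonneg hx.le (by linarith), (div_le_one (by linarith)).2 (by linarith)⟩
    · exact ⟨by linarith, div_nonneg_of_nonpos hx.le (by linarith),
        (div_le_one_of_neg (by linarith)).2 (by linarith)⟩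
  obtain ⟨hne₁, ht0, ht1⟩ := param _ _ h₁
  obtain ⟨hne₂, hs0, hs1⟩ := param _ _ h₂
  set t := signedArea a b c / (signedArea a b c - signedArea a b d) with ht
  set s := signedArea c d a / (signedArea c d a - signedArea c d b) with hs
  rw [eq_div_iff hne₁] at ht
  rw [eq_div_iff hne₂] at hs
  have heq : ∀ i, a i + s * (b i - a i) = c i + t * (d i - c i) := by
    intro i
    apply mul_right_cancel₀ hne₁
    unfold signedArea at *
    match i with
    | 0 => linear_combination (b 0 - a 0) * (-hs) - (d 0 - c 0) * ht
    | 1 => linear_combination (b 1 - a 1) * (-hs) - (d 1 - c 1) * ht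
  refine ⟨a + s • (b - a), (mem_segment_plane_iff _ _ _).2 ⟨s, hs0, hs1, fun i => by simp⟩,
    (mem_segment_plane_iff _ _ _).2 ⟨t, ht0, ht1, fun i => ?_⟩⟩
  rw [← heq]
  simp

/-- In general position, whether two segments meet is determined by orientations. -/
theorem segments_meet_iff_orient {a b c d : Plane} (habc : orient a b c ≠ 0)
    (habd : orient a b d ≠ 0) (hcda : orient c d a ≠ 0) (hcdb : orient c d b ≠ 0) :
    (segment ℝ a b ∩ segment ℝ c d).Nonempty ↔
      orient a b c * orient a b d < 0 ∧ orient c d a * orient c d b < 0 := by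
  rw [orient_ne_zero_iff] at habc habd hcda hcdb
  simp only [orient_eq_sign_signedArea, Real.sign_mul_sign_neg_iff]
  constructor
  · rintro ⟨z, hab, hcd⟩
    exact ⟨signedArea_mul_neg_of_segments_meet habc habd hab hcd,
      signedArea_mul_neg_of_segments_meet hcda hcdb hcd hab⟩
  · rintro ⟨h₁, h₂⟩
    exact segments_meet_of_signedArea_mul_neg h₁ h₂

theorem eq_of_mem_segments_of_orient_ne_zero {a b c z : Plane} (h : orient a b c ≠ 0)
    (hb : z ∈ segment ℝ a b) (hc : z ∈ segment ℝ a c) : z = a := by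
  rw [orient_ne_zero_iff] at h
  obtain ⟨s, -, -, hs⟩ := (mem_segment_plane_iff _ _ _).1 hb
  obtain ⟨t, -, -, ht⟩ := (mem_segment_plane_iff _ _ _).1 hc
  have key : s * signedArea a b c = 0 := by
    have h0 := hs 0
    have h1 := hs 1
    rw [ht] at h0 h1
    unfold signedArea
    linear_combination (c 0 - a 0) * h1 - (c 1 - a 1) * h0
  obtain rfl : s = 0 := (mul_eq_zero.1 key).resolve_right h
  ext i
  simp [hs i]

theorem orient_eq_zero_of_mem_segment {a b z : Plane} (h : z ∈ segment ℝ a b) :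
    orient a b z = 0 := by
  obtain ⟨s, -, -, hs⟩ := (mem_segment_plane_iff _ _ _).1 h
  rw [orient_eq_sign_signedArea, Real.sign_eq_zero_iff]
  unfold signedArea
  rw [hs, hs]
  ring

/-- The edges of `G` without a common endpoint are drawn by `π` as disjoint segments. -/
def DisjointEdgesApart {V : Type*} (G : SimpleGraph V) (π : V → Plane) : Prop :=
  ∀ u v x y : V, G.Adj u v → G.Adj x y → u ≠ x → u ≠ y → v ≠ x → v ≠ y →
    Disjoint (segment ℝ (π u) (π v)) (segment ℝ (π x) (π y))

theorem IsSLEmbedding.disjointEdgesApart {V : Type*} {G : SimpleGraph V} {π : V → Plane}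
    (h : IsSLEmbedding G π) : DisjointEdgesApart G π := by
  intro u v x y huv hxy hux huy hvx hvy
  rw [Set.disjoint_iff_inter_eq_empty, ← Set.subset_empty_iff]
  have := h.2.1 u v x y huv hxy (by simp [hux, huy])
  rwa [show (({u, v} : Set V) ∩ {x, y}) = ∅ by ext; grind, Set.image_empty] at this

theorem DisjointEdgesApart.isSLEmbedding {n : ℕ} {G : SimpleGraph (Fin n)} {p : Fin n → Plane}
    (hinj : Function.Injective p) (hp : GenPos p) (h : DisjointEdgesApart G p) :
    IsSLEmbedding G p := by
  refine ⟨hinj, ?_, ?_⟩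
  · rintro u v x y huv hxy hne z ⟨hz₁, hz₂⟩
    have adjacent : ∀ a b c, G.Adj a b → G.Adj a c → b ≠ c → z ∈ segment ℝ (p a) (p b) →
        z ∈ segment ℝ (p a) (p c) → z = p a := fun a b c hab hac hbc =>
      eq_of_mem_segments_of_orient_ne_zero (hp a b c hab.ne hac.ne hbc)
    by_cases hux : u = x
    · subst hux
      have hvy : v ≠ y := by rintro rfl; exact hne rfl
      exact ⟨u, by simp, (adjacent u v y huv hxy hvy hz₁ hz₂).symm⟩
    by_cases huy : u = y
    · subst huy
      have hvx : v ≠ x := by rintro rfl; exact hne Sym2.eq_swap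
      rw [segment_symm] at hz₂
      exact ⟨u, by simp, (adjacent u v x huv hxy.symm hvx hz₁ hz₂).symm⟩
    by_cases hvx : v = x
    · subst hvx
      rw [segment_symm] at hz₁
      exact ⟨v, by simp, (adjacent v u y huv.symm hxy huy hz₁ hz₂).symm⟩
    by_cases hvy : v = y
    · subst hvy
      rw [segment_symm] at hz₁ hz₂
      exact ⟨v, by simp, (adjacent v u x huv.symm hxy.symm hux hz₁ hz₂).symm⟩
    exact (Set.disjoint_left.1 (h u v x y huv hxy hux huy hvx hvy) hz₁ hz₂).elim
  · intro u v w huv hwu hwv hw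
    exact hp u v w huv.ne hwu.symm hwv.symm
      (orient_eq_zero_of_mem_segment (openSegment_subset_segment _ _ _ hw))

/-- Isomorphic labelled point sets agree on the orientation of every triple of distinct
indices, increasing or not. -/
theorem OTIso.orient_eq {n : ℕ} {p q : Fin n → Plane} (h : OTIso p q) {i j k : Fin n}
    (hij : i ≠ j) (hik : i ≠ k) (hjk : j ≠ k) :
    orient (p i) (p j) (p k) = orient (q i) (q j) (q k) := by
  have left := fun a b c (e : orient (p a) (p b) (p c) = orient (q a) (q b) (q c)) =>
    show orient (p b) (p a) (p c) = orient (q b) (q a) (q c) by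
      rw [orient_swap_left, e, ← orient_swap_left]
  have right := fun a b c (e : orient (p a) (p b) (p c) = orient (q a) (q b) (q c)) =>
    show orient (p a) (p c) (p b) = orient (q a) (q c) (q b) by
      rw [orient_swap_right, e, ← orient_swap_right]
  rcases lt_or_gt_of_ne hij with h₁ | h₁ <;> rcases lt_or_gt_of_ne hik with h₂ | h₂ <;>
    rcases lt_or_gt_of_ne hjk with h₃ | h₃
  · exact h i j k h₁ h₃
  · exact right _ _ _ (h i k j h₂ h₃)
  · exact absurd (h₁.trans h₃) h₂.not_gt
  · exact right _ _ _ (left _ _ _ (h k i j h₂ h₁))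
  · exact left _ _ _ (h j i k h₁ h₂)
  · exact absurd (h₁.trans h₂) h₃.not_gt
  · exact left _ _ _ (right _ _ _ (h j k i h₃ h₂))
  · exact left _ _ _ (right _ _ _ (left _ _ _ (h k j i h₃ h₁)))

/-- Straight-line embeddings transfer along relabelled isomorphic general position tuples. -/
theorem IsSLEmbedding.of_otIso {n : ℕ} {G : SimpleGraph (Fin n)} (p q : GPTuple n)
    (hpq : OTIso p.1 q.1) (σ : Equiv.Perm (Fin n)) (h : IsSLEmbedding G (p.1 ∘ σ)) :
    IsSLEmbedding G (q.1 ∘ σ) := by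
  have relabel : ∀ {r : Fin n → Plane}, GenPos r → GenPos (r ∘ σ) := fun hr i j k hij hik hjk =>
    hr _ _ _ (σ.injective.ne hij) (σ.injective.ne hik) (σ.injective.ne hjk)
  refine DisjointEdgesApart.isSLEmbedding (q.2.1.comp σ.injective) (relabel q.2.2) ?_
  intro u v x y huv hxy hux huy hvx hvy
  have hp := h.disjointEdgesApart u v x y huv hxy hux huy hvx hvy
  have ori : ∀ i j k, i ≠ j → i ≠ k → j ≠ k →
      orient ((p.1 ∘ σ) i) ((p.1 ∘ σ) j) ((p.1 ∘ σ) k) =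
        orient ((q.1 ∘ σ) i) ((q.1 ∘ σ) j) ((q.1 ∘ σ) k) := fun i j k hij hik hjk =>
    hpq.orient_eq (σ.injective.ne hij) (σ.injective.ne hik) (σ.injective.ne hjk)
  have meet : ∀ {r : Fin n → Plane}, GenPos r → _ := fun {r} hr =>
    segments_meet_iff_orient (hr u v x huv.ne hux hvx) (hr u v y huv.ne huy hvy)
      (hr x y u hxy.ne hux.symm huy.symm) (hr x y v hxy.ne hvx.symm hvy.symm)
  rw [Set.disjoint_iff_inter_eq_empty, ← Set.not_nonempty_iff_eq_empty] at hp ⊢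
  rwa [meet (relabel q.2.2), ← ori u v x huv.ne hux hvx, ← ori u v y huv.ne huy hvy,
    ← ori x y u hxy.ne hux.symm huy.symm, ← ori x y v hxy.ne hvx.symm hvy.symm,
    ← meet (relabel p.2.2)]

/-- Disjointness of two segments is an open condition on their endpoints. -/
theorem isOpen_disjoint_segments :
    IsOpen {e : Plane × Plane × Plane × Plane |
      Disjoint (segment ℝ e.1 e.2.1) (segment ℝ e.2.2.1 e.2.2.2)} := by
  let meeting : Set ((unitInterval × unitInterval) × (Plane × Plane × Plane × Plane)) :=
    {w | w.2.1 + (w.1.1 : ℝ) • (w.2.2.1 - w.2.1) =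
      w.2.2.2.1 + (w.1.2 : ℝ) • (w.2.2.2.2 - w.2.2.2.1)}
  have hclosed : IsClosed meeting := isClosed_eq (by fun_prop) (by fun_prop)
  have himage := isClosedMap_snd_of_compactSpace _ hclosed
  rw [← isClosed_compl_iff]
  convert himage using 1
  ext ⟨a, b, c, d⟩
  simp only [Set.mem_compl_iff, Set.mem_ofPred_eq, Set.not_disjoint_iff, segment_eq_image']
  constructor
  · rintro ⟨z, ⟨s, hs, rfl⟩, ⟨t, ht, heq⟩⟩
    exact ⟨((⟨s, hs⟩, ⟨t, ht⟩), (a, b, c, d)), heq.symm, rfl⟩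
  · rintro ⟨⟨⟨s, t⟩, e⟩, heq, rfl⟩
    exact ⟨_, ⟨s, s.2, rfl⟩, ⟨t, t.2, heq.symm⟩⟩

theorem isOpen_disjointEdgesApart {V : Type*} [Finite V] (G : SimpleGraph V) :
    IsOpen {π : V → Plane | DisjointEdgesApart G π} := by
  simp only [DisjointEdgesApart, Set.ofPred_forall]
  refine isOpen_iInter_of_finite fun u => isOpen_iInter_of_finite fun v =>
    isOpen_iInter_of_finite fun x => isOpen_iInter_of_finite fun y => ?_
  iterate 6 refine isOpen_iInter_of_finite fun _ => ?_
  exact isOpen_disjoint_segments.preimage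
    (f := fun π : V → Plane => (π u, π v, π x, π y)) (by fun_prop)

/-- Points on the parabola; no three of them are collinear. -/
def parabolaTuple (n : ℕ) (i : Fin n) : Plane := !₂[(i : ℝ), (i : ℝ) ^ 2]

theorem signedArea_parabolaTuple_ne_zero {n : ℕ} {i j k : Fin n} (hij : i ≠ j) (hik : i ≠ k)
    (hjk : j ≠ k) :
    signedArea (parabolaTuple n i) (parabolaTuple n j) (parabolaTuple n k) ≠ 0 := by
  have h : signedArea (parabolaTuple n i) (parabolaTuple n j) (parabolaTuple n k) =
      ((j : ℝ) - i) * ((k : ℝ) - i) * ((k : ℝ) - j) := by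
    simp [signedArea, parabolaTuple]
    ring
  have cast_ne : ∀ {a b : Fin n}, a ≠ b → ((b : ℝ) - a) ≠ 0 := fun hab =>
    sub_ne_zero.2 fun e => hab (Fin.ext (Nat.cast_injective e.symm))
  rw [h]
  exact mul_ne_zero (mul_ne_zero (cast_ne hij) (cast_ne hik)) (cast_ne hjk)

theorem eventually_quadratic_ne_zero {A : ℝ} (hA : A ≠ 0) (B C : ℝ) :
    ∀ᶠ t in 𝓝[≠] (0 : ℝ), A * t ^ 2 + B * t + C ≠ 0 := by
  open Polynomial in
  have hpoly : (Polynomial.C A * X ^ 2 + Polynomial.C B * X + Polynomial.C C : ℝ[X]) ≠ 0 := by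
    intro h
    have := congrArg (fun P : ℝ[X] => P.coeff 2) h
    simp at this
    exact hA this
  have hfin := Polynomial.finite_setOfPred_isRoot hpoly
  have := nhdsNE_le_cofinite (0 : ℝ) hfin.compl_mem_cofinite
  filter_upwards [this] with t ht
  simpa [Polynomial.IsRoot] using ht

theorem eventually_genPos_perturbation {n : ℕ} (p : Fin n → Plane) :
    ∀ᶠ t in 𝓝[≠] (0 : ℝ), GenPos (p + t • parabolaTuple n) := by
  simp only [GenPos, eventually_all]
  intro i j k hij hik hjk
  set v := parabolaTuple n
  filter_upwards [eventually_quadratic_ne_zero (signedArea_parabolaTuple_ne_zero hij hik hjk)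
    ((v j 0 - v i 0) * (p k 1 - p i 1) + (p j 0 - p i 0) * (v k 1 - v i 1)
      - (v j 1 - v i 1) * (p k 0 - p i 0) - (p j 1 - p i 1) * (v k 0 - v i 0))
    (signedArea (p i) (p j) (p k))] with t ht
  rw [orient_ne_zero_iff]
  convert ht using 1
  simp [signedArea]
  ring

theorem GenPos.injective {n : ℕ} (hn : 3 ≤ n) {p : Fin n → Plane} (hp : GenPos p) :
    Function.Injective p := by
  intro i j hij
  by_contra hne
  obtain ⟨k, hk⟩ := Finset.exists_mem_notMem_of_card_lt_card
    (s := {i, j}) (t := (Finset.univ : Finset (Fin n)))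
    (by rw [Finset.card_fin]; exact Finset.card_le_two.trans_lt hn)
  simp only [Finset.mem_univ, Finset.mem_insert, Finset.mem_singleton, not_or, true_and] at hk
  refine hp i j k hne (Ne.symm hk.1) (Ne.symm hk.2) ?_
  rw [orient_eq_sign_signedArea, hij]
  simp [signedArea]

/-- Graphs embeddable on a common point set are embeddable on relabellings of a single
general position tuple. -/
theorem exists_gpTuple_of_embedsOn {n m : ℕ} (hn : 3 ≤ n) (T : Fin (m + 1) → SimpleGraph (Fin n))
    (P : Set Plane) (h : ∀ i, EmbedsOn (T i) P) :
    ∃ (p : GPTuple n) (σ : Fin m → Equiv.Perm (Fin n)), IsSLEmbedding (T 0) p.1 ∧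
      ∀ i, IsSLEmbedding (T i.succ) (p.1 ∘ σ i) := by
  choose π hπ hrange using h
  have hσ : ∀ i, ∃ σ : Equiv.Perm (Fin n), π i = π 0 ∘ σ := by
    intro i
    have hmem : ∀ j, ∃ l, π 0 l = π i j := fun j => by
      have : π i j ∈ Set.range (π 0) := by rw [hrange 0, ← hrange i]; exact ⟨j, rfl⟩
      exact this
    choose f hf using hmem
    have hinj : Function.Injective f := fun a b hab => (hπ i).1 (by rw [← hf, ← hf, hab])
    exact ⟨Equiv.ofBijective f (Finite.injective_iff_bijective.1 hinj),
      funext fun j => (hf j).symm⟩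
  choose σ hσ using hσ
  have htendsto : ∀ τ : Equiv.Perm (Fin n),
      Tendsto (fun t : ℝ => (π 0 + t • parabolaTuple n) ∘ τ) (𝓝[≠] 0) (𝓝 (π 0 ∘ τ)) := by
    intro τ
    have hcont : Continuous fun t : ℝ => (π 0 + t • parabolaTuple n) ∘ τ :=
      continuous_pi fun i => by
        simp only [Function.comp_apply, Pi.add_apply, Pi.smul_apply]
        fun_prop
    refine (hcont.tendsto' 0 _ ?_).mono_left nhdsWithin_le_nhds
    simp
  have hev : ∀ i, ∀ᶠ t in 𝓝[≠] (0 : ℝ),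
      DisjointEdgesApart (T i) ((π 0 + t • parabolaTuple n) ∘ σ i) := fun i =>
    (htendsto (σ i)).eventually ((isOpen_disjointEdgesApart (T i)).mem_nhds
      (hσ i ▸ (hπ i).disjointEdgesApart))
  have hev₀ : ∀ᶠ t in 𝓝[≠] (0 : ℝ),
      DisjointEdgesApart (T 0) (π 0 + t • parabolaTuple n) :=
    (htendsto 1).eventually ((isOpen_disjointEdgesApart (T 0)).mem_nhds
      (hπ 0).disjointEdgesApart)
  obtain ⟨t, hgen, h₀, hrest⟩ :=
    ((eventually_genPos_perturbation (π 0)).and (hev₀.and (eventually_all.2 hev))).exists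
  refine ⟨⟨_, hgen.injective hn, hgen⟩, fun i => σ i.succ,
    h₀.isSLEmbedding (hgen.injective hn) hgen, fun i => ?_⟩
  exact (hrest i.succ).isSLEmbedding ((hgen.injective hn).comp (σ _).injective)
    fun a b c hab hac hbc => hgen _ _ _ ((σ _).injective.ne hab) ((σ _).injective.ne hac)
      ((σ _).injective.ne hbc)

theorem otIso_equivalence (n : ℕ) :
    Equivalence fun p q : GPTuple n => OTIso p.1 q.1 where
  refl _ _ _ _ _ _ := rfl
  symm h i j k hij hjk := (h i j k hij hjk).symm
  trans h h' i j k hij hjk := (h i j k hij hjk).trans (h' i j k hij hjk)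

theorem otIso_of_quot_eq {n : ℕ} {p q : GPTuple n}
    (h : Quot.mk (fun p q : GPTuple n => OTIso p.1 q.1) p = Quot.mk _ q) : OTIso p.1 q.1 :=
  (otIso_equivalence n).eqvGen_iff.1 (Quot.eqvGen_exact h)

instance finite_orderTypes (n : ℕ) : Finite (Quot fun p q : GPTuple n => OTIso p.1 q.1) := by
  let code : GPTuple n → Fin n → Fin n → Fin n → SignType := fun p i j k =>
    SignType.sign (orient (p.1 i) (p.1 j) (p.1 k))
  refine Finite.of_injective (fun c => code c.out) fun c d hcd => ?_
  rw [← Quot.out_eq c, ← Quot.out_eq d]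
  refine Quot.sound fun i j k hij hjk => ?_
  have h : SignType.sign (orient (c.out.1 i) (c.out.1 j) (c.out.1 k)) =
      SignType.sign (orient (d.out.1 i) (d.out.1 j) (d.out.1 k)) :=
    congrFun (congrFun (congrFun hcd i) j) k
  rw [orient_eq_sign_signedArea, orient_eq_sign_signedArea] at h ⊢
  rcases Real.sign_apply_eq (signedArea (c.out.1 i) (c.out.1 j) (c.out.1 k)) with h₁ | h₁ | h₁ <;>
    rcases Real.sign_apply_eq (signedArea (d.out.1 i) (d.out.1 j) (d.out.1 k))
      with h₂ | h₂ | h₂ <;> rw [h₁, h₂] at h ⊢ <;> simp at h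

/-- If `𝒯` is a nonempty finite family of labelled graphs on `{1,…,n}` such that every
labelled point set admits a label-preserving straight-line embedding of at most one member
of `𝒯`, and `t_s(n,2) · (n!)^{k-1} < |𝒯|^k`, then some `k` members of `𝒯` form a
collection that is not simultaneously embeddable. -/
theorem counting_conflict_collection (n k : ℕ) (hn : 4 ≤ n) (hk : 2 ≤ k)
    (𝒯 : Finset (SimpleGraph (Fin n))) (hne : 𝒯.Nonempty)
    (huniq : ∀ p : Fin n → Plane, Function.Injective p →
      ∀ T₁ ∈ 𝒯, ∀ T₂ ∈ 𝒯, IsSLEmbedding T₁ p → IsSLEmbedding T₂ p → T₁ = T₂)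
    (hcount : tS n * (Nat.factorial n) ^ (k - 1) < 𝒯.card ^ k) :
    ∃ T : Fin k → SimpleGraph (Fin n), (∀ i, T i ∈ 𝒯) ∧
      ¬ ∃ P : Finset Plane, P.card = n ∧ ∀ i, EmbedsOn (T i) ↑P := by
  obtain ⟨m, rfl⟩ : ∃ m, k = m + 1 := ⟨k - 1, by omega⟩
  by_contra! hall
  have hdraw : ∀ T : Fin (m + 1) → 𝒯, ∃ (p : GPTuple n) (σ : Fin m → Equiv.Perm (Fin n)),
      IsSLEmbedding (T 0 : SimpleGraph (Fin n)) p.1 ∧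
        ∀ i, IsSLEmbedding (T i.succ : SimpleGraph (Fin n)) (p.1 ∘ σ i) := fun T => by
    obtain ⟨P, -, hP⟩ := hall (fun i => T i) fun i => (T i).2
    exact exists_gpTuple_of_embedsOn (by omega) _ _ hP
  choose p σ hzero hsucc using hdraw
  let f : (Fin (m + 1) → 𝒯) →
      (Quot fun p q : GPTuple n => OTIso p.1 q.1) × (Fin m → Equiv.Perm (Fin n)) :=
    fun T => (Quot.mk _ (p T), σ T)
  have hf : Function.Injective f := by
    intro S T hST
    have hiso : OTIso (p S).1 (p T).1 := otIso_of_quot_eq (congrArg Prod.fst hST)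
    have hσ : σ S = σ T := congrArg Prod.snd hST
    funext i
    apply Subtype.ext
    refine Fin.cases ?_ (fun i => ?_) i
    · exact huniq _ (p T).2.1 _ (S 0).2 _ (T 0).2
        (IsSLEmbedding.of_otIso _ _ hiso 1 (hzero S)) (hzero T)
    · refine huniq ((p T).1 ∘ σ T i) ((p T).2.1.comp (σ T i).injective) _ (S _).2 _ (T _).2
        (IsSLEmbedding.of_otIso _ _ hiso _ ?_) (hsucc T i)
      rw [← hσ]
      exact hsucc S i
  have hcard := Nat.card_le_card_of_injective f hf
  rw [Nat.card_prod, Nat.card_fun, Nat.card_fun, Nat.card_perm] at hcard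
  simp only [Nat.card_eq_fintype_card, Fintype.card_fin, Fintype.card_coe] at hcard
  simp only [tS, Nat.add_sub_cancel] at hcount
  omega
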